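/- arXiv:1205.1012 — 6 statements merged into one kernel-verified Lean document; each statement's English description precedes it below -/
import Mathlib

section
/- The Hirsch h-index is the SRM associated with the performance curves f_q(x) = q·1_{(0,q]}(x): for every citation record with citation curve X, sup{q ≥ 0 : X(x) ≥ q·1_{(0,q]}(x) for all x ∈ ℝ} = h, where h = max{k ∈ {0,1,…,p} : x_i ≥ k for all 1 ≤ i ≤ k} is the h-index of the record. -/
open MeasureTheory

/-- A citation record: `p ≥ 1` publications with integer citation counts
`x₁ ≥ x₂ ≥ … ≥ x_p ≥ 1` (indexed from 1). -/
structure CitationRecord where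
  p : ℕ
  hp : 1 ≤ p
  x : ℕ → ℕ
  mono : ∀ i j : ℕ, 1 ≤ i → i ≤ j → j ≤ p → x j ≤ x i
  pos : ∀ i : ℕ, 1 ≤ i → i ≤ p → 1 ≤ x i

/-- The citation curve `X = Σ_{i=1}^p x_i · 1_{(i-1, i]}` of a citation record. -/
noncomputable def citCurve (r : CitationRecord) : ℝ → ℝ :=
  fun t => ∑ i ∈ Finset.Icc 1 r.p,
    (r.x i : ℝ) * (Set.Ioc ((i : ℝ) - 1) (i : ℝ)).indicator (fun _ => (1 : ℝ)) t

/-- The h-index: the greatest `k ∈ {0, 1, …, p}` with `x_i ≥ k` for all `1 ≤ i ≤ k`. -/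
noncomputable def hIndex (r : CitationRecord) : ℕ :=
  sSup {k : ℕ | k ≤ r.p ∧ ∀ i : ℕ, 1 ≤ i → i ≤ k → k ≤ r.x i}

theorem citCurve_of_pos (r : CitationRecord) (t : ℝ) (ht : 0 < t) :
    citCurve r t = if ⌈t⌉₊ ≤ r.p then (r.x ⌈t⌉₊ : ℝ) else 0 := by
  have hc : 1 ≤ ⌈t⌉₊ := Nat.one_le_iff_ne_zero.mpr (Nat.ceil_pos.mpr ht).ne'
  have key : ∀ i ∈ Finset.Icc 1 r.p,
      (r.x i : ℝ) * (Set.Ioc ((i : ℝ) - 1) (i : ℝ)).indicator (fun _ => (1 : ℝ)) t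
        = if i = ⌈t⌉₊ then (r.x i : ℝ) else 0 := by
    intro i hi
    have hi1 : i ≠ 0 := by have := (Finset.mem_Icc.mp hi).1; omega
    have hiff : t ∈ Set.Ioc ((i : ℝ) - 1) (i : ℝ) ↔ i = ⌈t⌉₊ := by
      rw [eq_comm, Nat.ceil_eq_iff hi1, Set.mem_Ioc,
        Nat.cast_sub (Nat.one_le_iff_ne_zero.mpr hi1), Nat.cast_one]
    by_cases h : i = ⌈t⌉₊
    · rw [Set.indicator_of_mem (hiff.mpr h), if_pos h, mul_one]
    · rw [Set.indicator_of_notMem (fun h' => h (hiff.mp h')), if_neg h, mul_zero]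
  unfold citCurve
  rw [Finset.sum_congr rfl key, Finset.sum_ite_eq']
  simp [hc]

theorem citCurve_nonneg (r : CitationRecord) (t : ℝ) : 0 ≤ citCurve r t := by
  unfold citCurve
  refine Finset.sum_nonneg fun i _ => mul_nonneg (Nat.cast_nonneg _) ?_
  exact Set.indicator_nonneg (fun _ _ => zero_le_one) _

/-- the Hirsch h-index is the SRM associated with the performance
curves `f_q = q · 1_{(0,q]}`. -/
theorem hIndex_eq_srm (r : CitationRecord) :
    sSup {q : ℝ | 0 ≤ q ∧
        ∀ t : ℝ, q * (Set.Ioc (0 : ℝ) q).indicator (fun _ => (1 : ℝ)) t ≤ citCurve r t}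
      = (hIndex r : ℝ) := by
  have hbdd : BddAbove {k : ℕ | k ≤ r.p ∧ ∀ i : ℕ, 1 ≤ i → i ≤ k → k ≤ r.x i} :=
    ⟨r.p, fun k hk => hk.1⟩
  have hmem : hIndex r ∈ {k : ℕ | k ≤ r.p ∧ ∀ i : ℕ, 1 ≤ i → i ≤ k → k ≤ r.x i} :=
    Nat.sSup_mem ⟨0, Nat.zero_le _, fun i _ _ => Nat.zero_le _⟩ hbdd
  obtain ⟨h1, h2⟩ := hmem
  apply IsGreatest.csSup_eq
  refine ⟨⟨Nat.cast_nonneg _, fun t => ?_⟩, ?_⟩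
  · by_cases ht : t ∈ Set.Ioc (0 : ℝ) (hIndex r : ℝ)
    · rw [Set.indicator_of_mem ht, mul_one, citCurve_of_pos r t ht.1]
      have hle : ⌈t⌉₊ ≤ hIndex r := Nat.ceil_le.mpr ht.2
      rw [if_pos (hle.trans h1)]
      exact_mod_cast h2 _ (Nat.ceil_pos.mpr ht.1) hle
    · rw [Set.indicator_of_notMem ht, mul_zero]
      exact citCurve_nonneg r t
  · rintro q ⟨hq0, hq⟩
    rcases hq0.eq_or_lt with h0 | hpos
    · rw [← h0]; exact Nat.cast_nonneg _
    have hqq := hq q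
    rw [Set.indicator_of_mem (show q ∈ Set.Ioc 0 q from ⟨hpos, le_rfl⟩), mul_one,
      citCurve_of_pos r q hpos] at hqq
    split_ifs at hqq with hc
    · have hx : ⌈q⌉₊ ≤ r.x ⌈q⌉₊ := Nat.ceil_le.mpr hqq
      have : ⌈q⌉₊ ≤ hIndex r :=
        le_csSup hbdd ⟨hc, fun i hi hik => hx.trans (r.mono i _ hi hik hc)⟩
      exact Nat.ceil_le.mp this
    · linarith
end

section
/- If the family of performance curves F = (f_q)_{q ∈ ℝ} is left continuous in q, then the performance sets coincide with the upper level sets of the SRM: for every q ∈ ℝ, A_q = {X ∈ L∞(μ) : φ_F(X) ≥ q}. -/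
open MeasureTheory Filter

/-- The space `L∞(μ)` of μ-essentially bounded Borel functions on ℝ. -/
def Linf (μ : Measure ℝ) : Set (ℝ → ℝ) :=
  {X | Measurable X ∧ ∃ C : ℝ, ∀ᵐ x ∂μ, |X x| ≤ C}

/-- A family of performance curves indexed by `q ∈ ℝ`: Borel-measurable nonnegative
functions, increasing in `q` μ-a.e. -/
structure PerfFamily (μ : Measure ℝ) where
  f : ℝ → ℝ → ℝ
  meas : ∀ q, Measurable (f q)
  nonneg : ∀ q x, 0 ≤ f q x
  mono : ∀ p q : ℝ, p ≤ q → ∀ᵐ x ∂μ, f p x ≤ f q x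

/-- `F` is left continuous in `q`: for every `q`, μ-a.e. `f_{q-ε}(x)` increases to
`f_q(x)` as `ε ↓ 0`. -/
def LeftContinuous (μ : Measure ℝ) (F : PerfFamily μ) : Prop :=
  ∀ q : ℝ, ∀ᵐ x ∂μ,
    (∀ ε δ : ℝ, 0 < ε → ε ≤ δ → F.f (q - δ) x ≤ F.f (q - ε) x) ∧
    Tendsto (fun ε : ℝ => F.f (q - ε) x) (nhdsWithin 0 (Set.Ioi 0)) (nhds (F.f q x))

/-- The performance set `A_q ⊆ L∞(μ)`. -/
def perfSet (μ : Measure ℝ) (F : PerfFamily μ) (q : ℝ) : Set (ℝ → ℝ) :=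
  {X ∈ Linf μ | ∀ᵐ x ∂μ, F.f q x ≤ X x}

/-- The scientific research measure associated to `F`, valued in the extended reals. -/
noncomputable def srm (μ : Measure ℝ) (F : PerfFamily μ) (X : ℝ → ℝ) : EReal :=
  sSup ((fun q : ℝ => (q : EReal)) '' {q : ℝ | ∀ᵐ x ∂μ, F.f q x ≤ X x})

/-- if `F` is left continuous in `q`, then the performance sets are
the upper level sets of the SRM. -/
theorem perfSet_eq_upperLevel (μ : Measure ℝ) [IsProbabilityMeasure μ]
    (F : PerfFamily μ) (hF : LeftContinuous μ F) (q : ℝ) :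
    perfSet μ F q = {X ∈ Linf μ | (q : EReal) ≤ srm μ F X} := by
  ext X
  constructor
  · rintro ⟨hX, h⟩
    exact ⟨hX, le_sSup ⟨q, h, rfl⟩⟩
  · rintro ⟨hX, h⟩
    refine ⟨hX, ?_⟩
    have key : ∀ p : ℝ, p < q → ∀ᵐ x ∂μ, F.f p x ≤ X x := by
      intro p hp
      have h1 : (p : EReal) < srm μ F X := lt_of_lt_of_le (EReal.coe_lt_coe_iff.2 hp) h
      obtain ⟨_, ⟨r, hr, rfl⟩, hpr⟩ := lt_sSup_iff.1 h1
      have hpr' : p < r := EReal.coe_lt_coe_iff.1 hpr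
      filter_upwards [F.mono p r hpr'.le, hr] with x h2 h3
      exact h2.trans h3
    obtain ⟨u, -, hu, hlim⟩ := exists_seq_strictAnti_tendsto (0 : ℝ)
    have hall : ∀ᵐ x ∂μ, ∀ n : ℕ, F.f (q - u n) x ≤ X x :=
      ae_all_iff.2 fun n => key _ (by linarith [hu n])
    filter_upwards [hF q, hall] with x h2 h3
    have hu' : Tendsto u atTop (nhdsWithin 0 (Set.Ioi 0)) :=
      tendsto_nhdsWithin_iff.2 ⟨hlim, Eventually.of_forall hu⟩
    exact le_of_tendsto' (h2.2.comp hu') h3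
end

section
/- If the family of performance curves F = (f_q)_{q ∈ ℝ} is left continuous in q, then the SRM φ_F is continuous from above: for every sequence (X_n) in L∞(μ) and X ∈ L∞(μ) with X_n decreasing to X μ-a.e., φ_F(X_n) decreases to φ_F(X). -/
open MeasureTheory Filter

/-- if `F` is left continuous in `q`, then the SRM is continuous from
above: if `Xₙ ∈ L∞(μ)` decreases to `X ∈ L∞(μ)` μ-a.e., then `φ_F(Xₙ)` decreases
to `φ_F(X)`. -/
theorem srm_continuousFromAbove (μ : Measure ℝ) [IsProbabilityMeasure μ]
    (F : PerfFamily μ) (hF : LeftContinuous μ F)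
    (Xs : ℕ → ℝ → ℝ) (X : ℝ → ℝ) (hXs : ∀ n, Xs n ∈ Linf μ) (hX : X ∈ Linf μ)
    (hdec : ∀ᵐ x ∂μ, (∀ n : ℕ, Xs (n + 1) x ≤ Xs n x) ∧
      Tendsto (fun n : ℕ => Xs n x) atTop (nhds (X x))) :
    (∀ n : ℕ, srm μ F (Xs (n + 1)) ≤ srm μ F (Xs n)) ∧
    Tendsto (fun n : ℕ => srm μ F (Xs n)) atTop (nhds (srm μ F X)) := by
  have hmono : ∀ Y Z : ℝ → ℝ, (∀ᵐ x ∂μ, Y x ≤ Z x) → srm μ F Y ≤ srm μ F Z := by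
    intro Y Z h
    apply sSup_le_sSup
    apply Set.image_mono
    intro q hq
    have hq' : ∀ᵐ x ∂μ, F.f q x ≤ Y x := hq
    show ∀ᵐ x ∂μ, F.f q x ≤ Z x
    filter_upwards [hq', h] with x h1 h2 using h1.trans h2
  have hstep : ∀ n : ℕ, srm μ F (Xs (n + 1)) ≤ srm μ F (Xs n) := by
    intro n
    apply hmono
    filter_upwards [hdec] with x hx using hx.1 n
  refine ⟨hstep, ?_⟩
  have hlim := tendsto_atTop_iInf (f := fun n : ℕ => srm μ F (Xs n)) (antitone_nat_of_succ_le hstep)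
  have heq : (⨅ n, srm μ F (Xs n)) = srm μ F X := by
    apply le_antisymm
    · apply EReal.le_of_forall_lt_iff_le.mp
      intro z hz
      by_contra hcon
      obtain ⟨r, hr1, hr2⟩ := EReal.lt_iff_exists_real_btwn.mp (not_le.mp hcon)
      have hall : ∀ n : ℕ, ∀ᵐ x ∂μ, F.f r x ≤ Xs n x := by
        intro n
        have hlt : (r : EReal) < srm μ F (Xs n) := hr2.trans_le (iInf_le _ n)
        obtain ⟨_, ⟨q, hq, rfl⟩, hrq⟩ := lt_sSup_iff.mp hlt
        have hq' : ∀ᵐ x ∂μ, F.f q x ≤ Xs n x := hq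
        have hle : r ≤ q := (EReal.coe_lt_coe_iff.mp hrq).le
        filter_upwards [F.mono r q hle, hq'] with x h1 h2 using h1.trans h2
      have hrX : ∀ᵐ x ∂μ, F.f r x ≤ X x := by
        filter_upwards [ae_all_iff.mpr hall, hdec] with x h1 h2
        exact ge_of_tendsto' h2.2 h1
      have : (r : EReal) ≤ srm μ F X := le_sSup ⟨r, hrX, rfl⟩
      exact absurd (hr1.trans_le this) (not_lt.mpr hz.le)
    · apply le_iInf
      intro n
      apply hmono
      filter_upwards [hdec] with x hx
      exact (antitone_nat_of_succ_le (f := fun n : ℕ => Xs n x) hx.1).le_of_tendsto hx.2 n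
  rw [← heq]
  exact hlim
end

section
/- Dual representation of the SRM: if the family of performance curves F = (f_q)_{q ∈ ℝ} is left continuous in q, then for every X ∈ L∞(μ), φ_F(X) = inf_{Z ∈ 𝒵} H(Z, ∫ Z X dμ), where the infimum is over the set 𝒵 of all Z ∈ L¹(μ) with Z ≥ 0 μ-a.e. and ∫ Z dμ = 1. -/
open MeasureTheory Filter

/-- The dual function `H(Z,t) = sup{φ_F(ξ) : ξ ∈ L∞(μ), ∫ Z ξ dμ ≤ t}`. -/
noncomputable def Hdual (μ : Measure ℝ) (F : PerfFamily μ) (Z : ℝ → ℝ) (t : ℝ) : EReal :=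
  sSup (srm μ F '' {ξ ∈ Linf μ | ∫ x, Z x * ξ x ∂μ ≤ t})

/-- dual representation of the SRM: if `F` is left continuous in `q`,
then `φ_F(X) = inf_{Z ∈ 𝒵} H(Z, E[ZX])`, where `𝒵` is the set of nonnegative
integrable densities. -/
theorem srm_dual_representation (μ : Measure ℝ) [IsProbabilityMeasure μ]
    (F : PerfFamily μ) (hF : LeftContinuous μ F) (X : ℝ → ℝ) (hX : X ∈ Linf μ) :
    srm μ F X =
      ⨅ Z ∈ {Z : ℝ → ℝ | Integrable Z μ ∧ (∀ᵐ x ∂μ, 0 ≤ Z x) ∧ ∫ x, Z x ∂μ = 1},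
        Hdual μ F Z (∫ x, Z x * X x ∂μ) := by
  apply le_antisymm
  · refine le_iInf₂ fun Z _ => ?_
    exact le_sSup ⟨X, ⟨hX, le_rfl⟩, rfl⟩
  · rw [← EReal.le_of_forall_lt_iff_le]
    intro q hq
    have hnot : ¬ ∀ᵐ x ∂μ, F.f q x ≤ X x := fun h =>
      absurd (le_sSup ⟨q, h, rfl⟩ : (q : EReal) ≤ srm μ F X) (not_le.mpr hq)
    have hXm := hX.1
    set B : Set ℝ := {x | X x < F.f q x} with hB
    have hBm : MeasurableSet B := measurableSet_lt hXm (F.meas q)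
    have hB0 : μ B ≠ 0 := by
      intro h
      apply hnot
      rw [ae_iff]
      simpa [not_le] using h
    have hBr : 0 < μ.real B := ENNReal.toReal_pos hB0 (measure_ne_top _ _)
    set Z : ℝ → ℝ := B.indicator (fun _ => (μ.real B)⁻¹) with hZ
    have hZi : Integrable Z μ := (integrable_const _).indicator hBm
    have hZ0 : ∀ x, 0 ≤ Z x := fun x =>
      Set.indicator_nonneg (fun _ _ => (inv_pos.mpr hBr).le) x
    have hZ1 : ∫ x, Z x ∂μ = 1 := by
      rw [hZ, integral_indicator_const _ hBm, smul_eq_mul]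
      exact mul_inv_cancel₀ hBr.ne'
    have hint : ∀ Y ∈ Linf μ, Integrable (fun x => Z x * Y x) μ := by
      rintro Y ⟨hYm, C, hC⟩
      exact hZi.mul_bdd hYm.aestronglyMeasurable (c := C) (by simpa using hC)
    refine iInf₂_le_of_le Z ⟨hZi, Eventually.of_forall hZ0, hZ1⟩ ?_
    apply sSup_le
    rintro _ ⟨ξ, ⟨hξ, hle⟩, rfl⟩
    apply sSup_le
    rintro _ ⟨r, hr, rfl⟩
    by_contra hlt
    have hqr : q ≤ r := by
      have := not_le.mp hlt
      exact (EReal.coe_lt_coe_iff.mp this).le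
    have hr' : ∀ᵐ x ∂μ, F.f r x ≤ ξ x := hr
    have hge : ∀ᵐ x ∂μ, F.f q x ≤ ξ x := by
      filter_upwards [hr', F.mono q r hqr] with x h1 h2 using h2.trans h1
    have hnn : 0 ≤ᵐ[μ] fun x => Z x * ξ x - Z x * X x := by
      filter_upwards [hge] with x hx
      by_cases hxB : x ∈ B
      · have h1 : X x < F.f q x := hxB
        have := mul_nonneg (hZ0 x) (by linarith : 0 ≤ ξ x - X x)
        simp only [Pi.zero_apply]
        linarith
      · simp [hZ, hxB]
    have hz : ∫ x, (Z x * ξ x - Z x * X x) ∂μ = 0 := by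
      apply le_antisymm _ (integral_nonneg_of_ae hnn)
      rw [integral_sub (hint ξ hξ) (hint X hX)]
      linarith
    rw [integral_eq_zero_iff_of_nonneg_ae hnn ((hint ξ hξ).sub (hint X hX))] at hz
    apply hnot
    filter_upwards [hz, hge] with x h1 h2
    by_contra h3
    have hxB : x ∈ B := not_le.mp h3
    have h4 : X x < F.f q x := hxB
    have h5 : Z x = (μ.real B)⁻¹ := by simp [hZ, hxB]
    have h6 : 0 < Z x * (ξ x - X x) := by
      rw [h5]
      exact mul_pos (inv_pos.mpr hBr) (by linarith)
    simp only [Pi.zero_apply] at h1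
    linarith
end

section
/- The right continuous version of the dual function admits the representation: if the family of performance curves F = (f_q)_{q ∈ ℝ} is left continuous in q, then for every Z ∈ L¹(μ) with Z ≥ 0 μ-a.e. and every t ∈ ℝ, H⁺(Z,t) := inf_{s > t} H(Z,s) = sup{q ∈ ℝ : γ(Z,q) ≤ t}, where γ(Z,q) = inf{∫ Z X dμ : X ∈ L∞(μ), φ_F(X) ≥ q}. -/
open MeasureTheory Filter

/-- `γ(Z,q) = inf{∫ Z X dμ : X ∈ L∞(μ), φ_F(X) ≥ q}`. -/
noncomputable def gammaDual (μ : Measure ℝ) (F : PerfFamily μ) (Z : ℝ → ℝ) (q : ℝ) : EReal :=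
  ⨅ X ∈ {X ∈ Linf μ | (q : EReal) ≤ srm μ F X}, ((∫ x, Z x * X x ∂μ : ℝ) : EReal)

/-- the right continuous version `H⁺(Z,t) = inf_{s > t} H(Z,s)` of the
dual function satisfies `H⁺(Z,t) = sup{q ∈ ℝ : γ(Z,q) ≤ t}`. -/
theorem Hplus_eq_sup_gamma (μ : Measure ℝ) [IsProbabilityMeasure μ]
    (F : PerfFamily μ) (hF : LeftContinuous μ F)
    (Z : ℝ → ℝ) (hZ : Integrable Z μ) (hZ0 : ∀ᵐ x ∂μ, 0 ≤ Z x) (t : ℝ) :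
    ⨅ s ∈ Set.Ioi t, Hdual μ F Z s =
      sSup ((fun q : ℝ => (q : EReal)) '' {q : ℝ | gammaDual μ F Z q ≤ (t : EReal)}) := by
  apply le_antisymm
  · by_contra hcon
    obtain ⟨q, hq1, hq2⟩ := EReal.lt_iff_exists_real_btwn.mp (not_le.mp hcon)
    refine absurd hq1 (not_lt.mpr (le_sSup ⟨q, ?_, rfl⟩))
    show gammaDual μ F Z q ≤ (t : EReal)
    refine EReal.le_of_forall_lt_iff_le.mp ?_
    intro s hs
    have hs' : t < s := by exact_mod_cast hs
    have h1 : (q : EReal) < Hdual μ F Z s :=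
      lt_of_lt_of_le hq2 (iInf₂_le s hs')
    obtain ⟨_, ⟨ξ, ⟨hξ, hint⟩, rfl⟩, hlt⟩ := lt_sSup_iff.mp h1
    refine le_trans (iInf₂_le ξ ⟨hξ, hlt.le⟩) ?_
    exact_mod_cast hint
  · refine sSup_le ?_
    rintro _ ⟨q, hq, rfl⟩
    refine le_iInf₂ ?_
    intro s hs
    have h1 : gammaDual μ F Z q < (s : EReal) :=
      lt_of_le_of_lt hq (by exact_mod_cast hs)
    obtain ⟨X, hX⟩ := iInf_lt_iff.mp h1
    obtain ⟨⟨hXL, hXq⟩, hlt⟩ := iInf_lt_iff.mp hX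
    have hlt' : ∫ x, Z x * X x ∂μ < s := by exact_mod_cast hlt
    exact le_trans hXq (le_sSup ⟨X, ⟨hXL, hlt'.le⟩, rfl⟩)
end

section
/- Dual representation of the h-index: let μ be a Borel measure on ℝ that is finite on bounded sets and satisfies μ((a,b]) > 0 for all 0 ≤ a < b, let X be the citation curve of a citation record (x₁,…,x_p), and let h = max{k ∈ {0,1,…,p} : x_i ≥ k for all 1 ≤ i ≤ k} be its h-index. Then inf_Z sup{q ≥ 0 : ∫ Z X dμ ≥ q ∫_{(0,q]} Z dμ} = h, where the infimum is taken over all μ-integrable functions Z : ℝ → [0,∞) and the supremum is valued in the extended reals. -/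
open MeasureTheory

theorem citCurve_of_mem (r : CitationRecord) (t : ℝ) (i : ℕ) (h1 : 1 ≤ i) (h2 : i ≤ r.p)
    (ht : t ∈ Set.Ioc ((i : ℝ) - 1) (i : ℝ)) : citCurve r t = r.x i := by
  unfold citCurve
  rw [Finset.sum_eq_single i]
  · simp [Set.indicator_of_mem ht]
  · intro j _ hj
    rw [Set.indicator_of_notMem, mul_zero]
    rintro ⟨h3, h4⟩
    apply hj
    have a : (j : ℝ) < i + 1 := by linarith [ht.2]
    have b : (i : ℝ) < j + 1 := by linarith [ht.1]
    norm_cast at a b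
    omega
  · intro h
    exact absurd (Finset.mem_Icc.2 ⟨h1, h2⟩) h

theorem citCurve_of_gt (r : CitationRecord) (t : ℝ) (ht : (r.p : ℝ) < t) :
    citCurve r t = 0 := by
  unfold citCurve
  apply Finset.sum_eq_zero
  intro j hj
  rw [Set.indicator_of_notMem, mul_zero]
  rintro ⟨h3, h4⟩
  have : (j : ℝ) ≤ r.p := by exact_mod_cast (Finset.mem_Icc.1 hj).2
  linarith

theorem citCurve_le (r : CitationRecord) (t : ℝ) :
    citCurve r t ≤ ∑ i ∈ Finset.Icc 1 r.p, (r.x i : ℝ) := by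
  unfold citCurve
  apply Finset.sum_le_sum
  intro j _
  apply mul_le_of_le_one_right (Nat.cast_nonneg _)
  exact Set.indicator_apply_le' (fun _ => le_rfl) (fun _ => zero_le_one)

theorem citCurve_measurable (r : CitationRecord) : Measurable (citCurve r) := by
  unfold citCurve
  exact Finset.measurable_sum _ fun i _ =>
    (measurable_const.indicator measurableSet_Ioc).const_mul _

theorem ceil_mem (t : ℝ) (ht : 0 < t) :
    1 ≤ ⌈t⌉₊ ∧ t ∈ Set.Ioc ((⌈t⌉₊ : ℝ) - 1) (⌈t⌉₊ : ℝ) :=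
  ⟨Nat.one_le_ceil_iff.2 ht, by linarith [Nat.ceil_lt_add_one ht.le], Nat.le_ceil t⟩

theorem hIndex_bdd (r : CitationRecord) :
    BddAbove {k : ℕ | k ≤ r.p ∧ ∀ i : ℕ, 1 ≤ i → i ≤ k → k ≤ r.x i} :=
  ⟨r.p, fun _ hk => hk.1⟩

theorem hIndex_spec (r : CitationRecord) :
    hIndex r ≤ r.p ∧ ∀ i : ℕ, 1 ≤ i → i ≤ hIndex r → hIndex r ≤ r.x i :=
  Nat.sSup_mem (s := {k : ℕ | k ≤ r.p ∧ ∀ i : ℕ, 1 ≤ i → i ≤ k → k ≤ r.x i})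
    ⟨0, by simp⟩ (hIndex_bdd r)

theorem x_le_hIndex (r : CitationRecord) (i : ℕ) (h1 : hIndex r < i) (h2 : i ≤ r.p) :
    r.x i ≤ hIndex r := by
  by_contra! hlt
  have : hIndex r + 1 ≤ hIndex r := by
    apply le_csSup (hIndex_bdd r)
    refine ⟨by omega, fun j hj1 hj2 => ?_⟩
    have := r.mono j i hj1 (by omega) h2
    omega
  omega

theorem le_citCurve (r : CitationRecord) (t : ℝ) (h0 : 0 < t) (h1 : t ≤ hIndex r) :
    (hIndex r : ℝ) ≤ citCurve r t := by
  obtain ⟨a, b⟩ := ceil_mem t h0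
  have c : ⌈t⌉₊ ≤ hIndex r := Nat.ceil_le.2 h1
  rw [citCurve_of_mem r t _ a (c.trans (hIndex_spec r).1) b]
  exact_mod_cast (hIndex_spec r).2 _ a c

theorem citCurve_le_hIndex (r : CitationRecord) (t : ℝ) (h1 : (hIndex r : ℝ) < t) :
    citCurve r t ≤ hIndex r := by
  rcases lt_or_ge (r.p : ℝ) t with h | h
  · rw [citCurve_of_gt r t h]; positivity
  · obtain ⟨a, b⟩ := ceil_mem t (lt_of_le_of_lt (Nat.cast_nonneg _) h1)
    have c : ⌈t⌉₊ ≤ r.p := Nat.ceil_le.2 h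
    rw [citCurve_of_mem r t _ a c b]
    exact_mod_cast x_le_hIndex r _ (Nat.lt_ceil.2 h1) c

theorem integrable_mul_citCurve (μ : Measure ℝ) (r : CitationRecord) (Z : ℝ → ℝ)
    (hZ : Integrable Z μ) : Integrable (fun x => Z x * citCurve r x) μ := by
  apply hZ.mul_bdd (c := ∑ i ∈ Finset.Icc 1 r.p, (r.x i : ℝ))
    (citCurve_measurable r).aestronglyMeasurable
  refine Filter.Eventually.of_forall fun t => ?_
  rw [Real.norm_of_nonneg (citCurve_nonneg r t)]
  exact citCurve_le r t

/-- dual representation of the h-index. For a Borel measure `μ` on `ℝ`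
which is finite on bounded sets and charges every interval `(a,b]` with `0 ≤ a < b`,
the infimum over nonnegative integrable weights `Z` of
`sup{q ≥ 0 : ∫ Z X dμ ≥ q ∫_{(0,q]} Z dμ}` equals the h-index. -/
theorem hIndex_dual (μ : Measure ℝ)
    (hfin : ∀ a b : ℝ, μ (Set.Icc a b) < ⊤)
    (hpos : ∀ a b : ℝ, 0 ≤ a → a < b → 0 < μ (Set.Ioc a b))
    (r : CitationRecord) :
    ⨅ Z ∈ {Z : ℝ → ℝ | Integrable Z μ ∧ ∀ x, 0 ≤ Z x},
        sSup ((fun q : ℝ => (q : EReal)) ''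
          {q : ℝ | 0 ≤ q ∧
            q * ∫ x in Set.Ioc (0 : ℝ) q, Z x ∂μ ≤ ∫ x, Z x * citCurve r x ∂μ})
      = (hIndex r : EReal) := by
  apply le_antisymm
  · refine EReal.le_of_forall_lt_iff_le.1 fun z hz => ?_
    have hz' : (hIndex r : ℝ) < z := by exact_mod_cast hz
    have hh : (0 : ℝ) ≤ hIndex r := Nat.cast_nonneg _
    set S := Set.Ioc (hIndex r : ℝ) z with hS
    have hSfin : μ S ≠ ⊤ := ((measure_mono Set.Ioc_subset_Icc_self).trans_lt (hfin _ _)).ne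
    have hm : 0 < μ.real S := ENNReal.toReal_pos (hpos _ _ hh hz').ne' hSfin
    have hint : Integrable (S.indicator fun _ => (1 : ℝ)) μ :=
      (integrable_indicator_iff measurableSet_Ioc).2 (integrableOn_const hSfin)
    refine (iInf₂_le (S.indicator fun _ => (1 : ℝ))
      ⟨hint, fun x => Set.indicator_nonneg (fun _ _ => zero_le_one) x⟩).trans ?_
    apply sSup_le
    rintro _ ⟨q, ⟨hq0, hq⟩, rfl⟩
    simp only [EReal.coe_le_coe_iff]
    by_contra! hlt
    have h1 : ∫ x in Set.Ioc (0 : ℝ) q, S.indicator (fun _ => (1 : ℝ)) x ∂μ = μ.real S := by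
      have hsub : S ⊆ Set.Ioc (0 : ℝ) q := Set.Ioc_subset_Ioc hh hlt.le
      rw [setIntegral_indicator measurableSet_Ioc, Set.inter_eq_right.2 hsub]
      simp
    have h2 : ∫ x, S.indicator (fun _ => (1 : ℝ)) x * citCurve r x ∂μ
        ≤ ∫ x, S.indicator (fun _ => (1 : ℝ)) x * (hIndex r : ℝ) ∂μ := by
      apply integral_mono (integrable_mul_citCurve μ r _ hint) (hint.mul_const _)
      intro x
      by_cases hx : x ∈ S
      · simpa [hx] using citCurve_le_hIndex r x hx.1
      · simp [hx]
    rw [integral_mul_const, integral_indicator measurableSet_Ioc] at h2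
    simp only [integral_const, smul_eq_mul, mul_one, measureReal_restrict_apply_univ] at h2
    rw [h1] at hq
    nlinarith
  · refine le_iInf₂ fun Z hZ => le_sSup ⟨(hIndex r : ℝ), ⟨Nat.cast_nonneg _, ?_⟩, by simp⟩
    obtain ⟨hZi, hZ0⟩ := hZ
    have hi := integrable_mul_citCurve μ r Z hZi
    rw [← integral_const_mul]
    calc _ ≤ ∫ x in Set.Ioc (0 : ℝ) (hIndex r), Z x * citCurve r x ∂μ := by
          apply setIntegral_mono_on (hZi.integrableOn.const_mul _) hi.integrableOn
            measurableSet_Ioc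
          intro x hx
          rw [mul_comm]
          exact mul_le_mul_of_nonneg_left (le_citCurve r x hx.1 hx.2) (hZ0 x)
      _ ≤ _ := setIntegral_le_integral hi (Filter.Eventually.of_forall fun x =>
          mul_nonneg (hZ0 x) (citCurve_nonneg r x))
end
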